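/- Let n be odd and let Z be a positive semidefinite operator on H. Then there exists a compatibility witness W ∈ O with p(W) = Δ(Z). -/

import Mathlib

open Matrix BigOperators
open scoped ComplexOrder

namespace Compat

noncomputable section

variable {n : ℕ} (d : Fin n → ℕ)

/-- The index type of the full tensor product `H = H_1 ⊗ ⋯ ⊗ H_n`,
where `H_i = ℂ^{d i}`; operators on `H` are matrices indexed by `Idx d`. -/
abbrev Idx : Type := ∀ i, Fin (d i)

/-- The index type of the tensor product of the factors `H_i` with `i ∈ A`. -/
abbrev SubIdx (A : Finset (Fin n)) : Type := ∀ i : A, Fin (d i.1)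

/-- Combine an assignment on `B` and one on `Bᶜ` into a full assignment. -/
def glue (B : Finset (Fin n)) (x : SubIdx d B) (z : SubIdx d Bᶜ) : Idx d :=
  fun i => if h : i ∈ B then x ⟨i, h⟩ else z ⟨i, Finset.mem_compl.mpr h⟩

/-- Partial trace keeping the factors in `B` (i.e. tracing out the factors in `Bᶜ`). -/
def reduce (B : Finset (Fin n)) (M : Matrix (Idx d) (Idx d) ℂ) :
    Matrix (SubIdx d B) (SubIdx d B) ℂ :=
  fun x y => ∑ z : SubIdx d Bᶜ, M (glue d B x z) (glue d B y z)

/-- Place an operator acting on the factors in `B`, tensored with the identity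
on the remaining factors, as an operator on the full space `H`. -/
def embed (B : Finset (Fin n)) (W : Matrix (SubIdx d B) (SubIdx d B) ℂ) :
    Matrix (Idx d) (Idx d) ℂ :=
  fun x y =>
    if ∀ i ∈ Bᶜ, x i = y i then W (fun i => x i.1) (fun i => y i.1) else 0

/-- Index type for `H^(i) = ⊗_{j ≠ i} H_j`. -/
abbrev RedIdx (i : Fin n) := SubIdx d ({i}ᶜ)

/-- The space `O` of `n`-tuples of operators, the `i`-th acting on `H^(i)`. -/
abbrev Tuple := ∀ i : Fin n, Matrix (RedIdx d i) (RedIdx d i) ℂ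

/-- Membership in (the Hermitian tuples space) `O`: every component is Hermitian. -/
def IsHermTuple (W : Tuple d) : Prop := ∀ i, (W i).IsHermitian

/-- A density state: positive semidefinite with trace one. -/
def IsDensity {m : Type*} [Fintype m] (M : Matrix m m ℂ) : Prop :=
  M.PosSemidef ∧ M.trace = 1

/-- The set `C`: a tuple `σ` lies in `C` iff there is a density state `ρ` on the
full space whose one-system partial traces are the `σ i`. -/
def MemC (σ : Tuple d) : Prop :=
  ∃ ρ : Matrix (Idx d) (Idx d) ℂ, IsDensity ρ ∧ ∀ i, σ i = reduce d ({i}ᶜ) ρ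

/-- The inner product `⟨⟨A,B⟩⟩ = Σ_i Tr(A_i B_i)` on `O` (a real number, since the
traces are real for Hermitian tuples). -/
def cwip (A B : Tuple d) : ℝ := (∑ i, ((A i) * (B i)).trace).re

/-- A compatibility witness: an element of `O` pairing nonnegatively with all of `C`. -/
def IsWitness (W : Tuple d) : Prop :=
  IsHermTuple d W ∧ ∀ ρ, MemC d ρ → 0 ≤ cwip d W ρ

/-- `p(W) = Σ_i W_i ⊗ 1_i`. -/
def pW (W : Tuple d) : Matrix (Idx d) (Idx d) ℂ :=
  ∑ i, embed d ({i}ᶜ) (W i)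

/-- `Δ(Z) = Σ_{A ⊊ N} (−1)^{|A|} (Tr_{N∖A} Z) ⊗ 1_{N∖A}`. -/
def Δop (Z : Matrix (Idx d) (Idx d) ℂ) : Matrix (Idx d) (Idx d) ℂ :=
  ∑ A ∈ Finset.univ.filter (fun A : Finset (Fin n) => A ≠ Finset.univ),
    ((-1 : ℂ) ^ A.card) • embed d A (reduce d A Z)

/-- The tensor product `T_1 ⊗ ⋯ ⊗ T_n` of one-system operators. -/
def tensorAll (T : ∀ i, Matrix (Fin (d i)) (Fin (d i)) ℂ) :
    Matrix (Idx d) (Idx d) ℂ :=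
  fun x y => ∏ i, T i (x i) (y i)

/-- Partial trace from the factors in `B` down to the factors in `B'` (for `B' ⊆ B`). -/
def reduceSub (B B' : Finset (Fin n)) (M : Matrix (SubIdx d B) (SubIdx d B) ℂ) :
    Matrix (SubIdx d B') (SubIdx d B') ℂ :=
  fun x y => ∑ z : SubIdx d (B \ B'),
    M (fun i => if h : i.1 ∈ B' then x ⟨i.1, h⟩ else z ⟨i.1, Finset.mem_sdiff.mpr ⟨i.2, h⟩⟩)
      (fun i => if h : i.1 ∈ B' then y ⟨i.1, h⟩ else z ⟨i.1, Finset.mem_sdiff.mpr ⟨i.2, h⟩⟩)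

/-- A tuple of subsystem states has consistent overlapping partial traces if
tracing the `j`-factor out of `σ_i` agrees with tracing the `i`-factor out of `σ_j`. -/
def HasConsistentTraces (σ : Tuple d) : Prop :=
  ∀ i j : Fin n, i ≠ j →
    reduceSub d ({i}ᶜ) ({i}ᶜ ∩ {j}ᶜ) (σ i) = reduceSub d ({j}ᶜ) ({i}ᶜ ∩ {j}ᶜ) (σ j)

/-- The tuple `I` of reduced states of the maximally mixed state `1_H / D`. -/
def Itup : Tuple d :=
  fun i => ((d i : ℂ) / (∏ k, (d k : ℂ))) • (1 : Matrix (RedIdx d i) (RedIdx d i) ℂ)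

/-- A positive tuple: all components positive semidefinite. -/
def PosTuple (σ : Tuple d) : Prop := ∀ i, (σ i).PosSemidef

/-- A normalized witness: `⟨⟨W, I⟩⟩ = 1` (equivalently `Tr p(W) = 1`). -/
def Normalized (W : Tuple d) : Prop := cwip d W (Itup d) = 1

/-- `W'` is finer than `W`. -/
def Finer (W' W : Tuple d) : Prop :=
  ∀ σ, PosTuple d σ → cwip d W σ < 0 → cwip d W' σ < 0

/-- `λ(W, W') = inf_{σ ∈ D_W} |⟨⟨W',σ⟩⟩| / |⟨⟨W,σ⟩⟩|`. -/
def lam (W W' : Tuple d) : ℝ :=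
  sInf {t | ∃ σ, PosTuple d σ ∧ cwip d W σ < 0 ∧ t = |cwip d W' σ| / |cwip d W σ|}

end
end Compat

open Matrix BigOperators
open scoped ComplexOrder

namespace Compat

section helpers

variable {n : ℕ} (d : Fin n → ℕ)

def glueEquiv (B : Finset (Fin n)) : (SubIdx d B × SubIdx d Bᶜ) ≃ Idx d where
  toFun p := glue d B p.1 p.2
  invFun x := (fun i => x i.1, fun i => x i.1)
  left_inv p := by
    ext i
    · simp [glue]
    · have := Finset.mem_compl.mp i.2
      simp [glue, this]
  right_inv x := by
    ext i
    simp [glue]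

theorem glue_mem (B : Finset (Fin n)) (x : SubIdx d B) (z : SubIdx d Bᶜ) (i : B) :
    glue d B x z i.1 = x i := by simp [glue]

theorem glue_not_mem (B : Finset (Fin n)) (x : SubIdx d B) (z : SubIdx d Bᶜ)
    (i : (Bᶜ : Finset (Fin n))) :
    glue d B x z i.1 = z i := by
  have := Finset.mem_compl.mp i.2
  simp [glue, this]

theorem sum_glue (B : Finset (Fin n)) (f : Idx d → ℂ) :
    ∑ x, f x = ∑ a : SubIdx d B, ∑ z : SubIdx d Bᶜ, f (glue d B a z) := by
  rw [← (glueEquiv d B).sum_comp, Fintype.sum_prod_type]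
  rfl

theorem embed_glue (B : Finset (Fin n)) (W : Matrix (SubIdx d B) (SubIdx d B) ℂ)
    (a b : SubIdx d B) (z w : SubIdx d Bᶜ) :
    embed d B W (glue d B a z) (glue d B b w) = if z = w then W a b else 0 := by
  have h : (∀ i ∈ Bᶜ, glue d B a z i = glue d B b w i) ↔ z = w := by
    constructor
    · intro h
      ext1 i
      have := h i.1 i.2
      rwa [glue_not_mem, glue_not_mem] at this
    · rintro rfl i hi
      rw [glue_not_mem d B a z ⟨i, hi⟩, glue_not_mem d B b z ⟨i, hi⟩]
  simp only [embed, h, glue_mem]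

theorem trace_embed_mul (B : Finset (Fin n)) (W : Matrix (SubIdx d B) (SubIdx d B) ℂ)
    (ρ : Matrix (Idx d) (Idx d) ℂ) :
    (W * reduce d B ρ).trace = (embed d B W * ρ).trace := by
  simp only [Matrix.trace, Matrix.diag, Matrix.mul_apply]
  rw [sum_glue d B]
  simp only [sum_glue d B (fun y => embed d B W _ y * ρ y _), embed_glue, ite_mul, zero_mul,
    Finset.sum_ite_eq, Finset.mem_univ, if_true, reduce, Finset.mul_sum]
  refine Finset.sum_congr rfl fun a _ => ?_
  rw [Finset.sum_comm]

theorem reduce_herm (B : Finset (Fin n)) {Z : Matrix (Idx d) (Idx d) ℂ} (h : Z.IsHermitian) :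
    (reduce d B Z).IsHermitian := by
  ext x y
  simp only [Matrix.conjTranspose_apply, reduce, star_sum]
  exact Finset.sum_congr rfl fun z _ => h.apply _ _

theorem embed_herm (B : Finset (Fin n)) {W : Matrix (SubIdx d B) (SubIdx d B) ℂ}
    (h : W.IsHermitian) : (embed d B W).IsHermitian := by
  ext x y
  have e : (∀ i ∈ Bᶜ, y i = x i) ↔ (∀ i ∈ Bᶜ, x i = y i) := by
    simp only [eq_comm]
  simp only [Matrix.conjTranspose_apply, embed, e]
  split_ifs
  · exact h.apply _ _
  · simp

theorem trace_mul_nonneg {m : Type*} [Fintype m] {A B : Matrix m m ℂ}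
    (hA : A.PosSemidef) (hB : B.PosSemidef) : 0 ≤ (A * B).trace := by
  classical
  obtain ⟨k, v, rfl⟩ := Matrix.posSemidef_iff_eq_sum_vecMulVec.mp hB
  rw [Matrix.mul_sum, Matrix.trace_sum]
  refine Finset.sum_nonneg fun i _ => ?_
  rw [Matrix.mul_vecMulVec, Matrix.trace_vecMulVec, dotProduct_comm]
  exact hA.dotProduct_mulVec_nonneg _

/-- The full alternating sum, equal to the tensor product of reduction maps. -/
noncomputable def full (Z : Matrix (Idx d) (Idx d) ℂ) : Matrix (Idx d) (Idx d) ℂ :=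
  ∑ A : Finset (Fin n), ((-1 : ℂ) ^ A.card) • embed d A (reduce d A Z)

theorem embed_univ (Z : Matrix (Idx d) (Idx d) ℂ) :
    embed d Finset.univ (reduce d Finset.univ Z) = Z := by
  ext x y
  haveI : IsEmpty {i // i ∈ (Finset.univ : Finset (Fin n))ᶜ} := ⟨fun i => by simpa using i.2⟩
  have g : ∀ (x : Idx d) z, glue d Finset.univ (fun i => x i.1) z = x := by
    intro x z
    funext i
    simp [glue]
  have hc : ∀ i ∈ (Finset.univ : Finset (Fin n))ᶜ, x i = y i := by simp
  have h1 : Fintype.card (SubIdx d (Finset.univ : Finset (Fin n))ᶜ) = 1 := by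
    rw [Fintype.card_eq_one_iff]
    exact ⟨fun i => isEmptyElim i, fun z => Subsingleton.elim _ _⟩
  simp only [embed, reduce, if_pos hc, g, Finset.sum_const, Finset.card_univ, h1, one_smul]

theorem delta_eq (hodd : Odd n) (Z : Matrix (Idx d) (Idx d) ℂ) :
    Δop d Z = full d Z + Z := by
  unfold full Δop
  rw [Finset.filter_ne' Finset.univ (Finset.univ : Finset (Fin n)),
    ← Finset.add_sum_erase _ _ (Finset.mem_univ (Finset.univ : Finset (Fin n))), embed_univ]
  simp [hodd.neg_one_pow]

/-- indicator -/
noncomputable def ind {m : Type*} [DecidableEq m] (a b : m) : ℂ := if a = b then 1 else 0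

theorem embed_reduce_eq (A : Finset (Fin n)) (Z : Matrix (Idx d) (Idx d) ℂ) (x y : Idx d) :
    embed d A (reduce d A Z) x y = ∑ v, ∑ u,
      (∏ i ∈ Aᶜ, ind (x i) (y i) * ind (u i) (v i)) *
      (∏ i ∈ A, ind (x i) (v i) * ind (u i) (y i)) * Z v u := by
  have key : ∀ (a b : SubIdx d A) (z w : SubIdx d Aᶜ),
      (∏ i ∈ Aᶜ, ind (x i) (y i) * ind (glue d A b w i) (glue d A a z i)) *
      (∏ i ∈ A, ind (x i) (glue d A a z i) * ind (glue d A b w i) (y i)) =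
      (if ∀ i ∈ Aᶜ, x i = y i then 1 else 0) * (if w = z then 1 else 0) *
      ((if (fun i : A => x i.1) = a then 1 else 0) * (if (fun i : A => y i.1) = b then 1 else 0)) := by
    intro a b z w
    simp only [ind, Finset.prod_mul_distrib, Finset.prod_ite_zero, Finset.prod_const_one]
    have e1 : (∀ i ∈ Aᶜ, glue d A b w i = glue d A a z i) ↔ w = z := by
      constructor
      · intro h
        ext1 i
        have := h i.1 i.2
        rwa [glue_not_mem, glue_not_mem] at this
      · rintro rfl i hi
        rw [glue_not_mem d A a w ⟨i, hi⟩, glue_not_mem d A b w ⟨i, hi⟩]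
    have e2 : (∀ i ∈ A, x i = glue d A a z i) ↔ (fun i : A => x i.1) = a := by
      constructor
      · intro h
        ext1 i
        have := h i.1 i.2
        rwa [glue_mem] at this
      · rintro rfl i hi
        rw [glue_mem d A _ z ⟨i, hi⟩]
    have e3 : (∀ i ∈ A, glue d A b w i = y i) ↔ (fun i : A => y i.1) = b := by
      constructor
      · intro h
        ext1 i
        have := h i.1 i.2
        rw [glue_mem] at this
        exact this.symm
      · rintro rfl i hi
        rw [glue_mem d A _ w ⟨i, hi⟩]
    simp only [e1, e2, e3]
  rw [sum_glue d A]
  simp only [fun v => sum_glue d A (fun u => (∏ i ∈ Aᶜ, ind (x i) (y i) * ind (u i) (v i)) *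
      (∏ i ∈ A, ind (x i) (v i) * ind (u i) (y i)) * Z v u), key]
  by_cases h : ∀ i ∈ Aᶜ, x i = y i
  · simp only [embed, reduce, if_pos h, one_mul, mul_ite, ite_mul, mul_one, mul_zero, zero_mul,
      Finset.sum_ite_eq, Finset.sum_ite_eq', Finset.mem_univ, if_true, Finset.sum_ite_irrel,
      Finset.sum_const_zero]
  · simp only [embed, if_neg h, zero_mul, Finset.sum_const_zero]

theorem full_apply (Z : Matrix (Idx d) (Idx d) ℂ) (x y : Idx d) :
    full d Z x y = ∑ v, ∑ u,
      (∏ i, (ind (x i) (y i) * ind (u i) (v i) - ind (x i) (v i) * ind (u i) (y i))) * Z v u := by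
  simp only [full, Matrix.sum_apply, Matrix.smul_apply, embed_reduce_eq, smul_eq_mul,
    Finset.prod_sub, Finset.powerset_univ, ← Finset.compl_eq_univ_sdiff, Finset.sum_mul,
    Finset.mul_sum]
  rw [Finset.sum_comm]
  refine Finset.sum_congr rfl fun v _ => ?_
  rw [Finset.sum_comm]
  refine Finset.sum_congr rfl fun u _ => Finset.sum_congr rfl fun A _ => ?_
  ring

noncomputable def kk {m : ℕ} (p : Fin m × Fin m) (x u : Fin m) : ℂ :=
  ind x p.1 * ind u p.2 - ind x p.2 * ind u p.1

theorem site {m : ℕ} (x y u v : Fin m) :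
    ∑ p : Fin m × Fin m, kk p x u * kk p y v =
      2 * (ind x y * ind u v - ind x v * ind u y) := by
  have o : ∀ a b : Fin m, ∑ c, ind a c * ind b c = ind a b := by
    intro a b
    simp [ind, eq_comm]
  have s : ∀ a b : Fin m, ind a b = ind b a := by
    intro a b
    simp [ind, eq_comm]
  have e : ∑ p : Fin m × Fin m, kk p x u * kk p y v =
      (∑ c, ind x c * ind y c) * (∑ c, ind u c * ind v c)
      - (∑ c, ind x c * ind v c) * (∑ c, ind u c * ind y c)
      - (∑ c, ind u c * ind y c) * (∑ c, ind x c * ind v c)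
      + (∑ c, ind u c * ind v c) * (∑ c, ind x c * ind y c) := by
    simp only [Finset.sum_mul_sum, Fintype.sum_prod_type, ← Finset.sum_sub_distrib,
      ← Finset.sum_add_distrib, kk]
    exact Finset.sum_congr rfl fun _ _ => Finset.sum_congr rfl fun _ _ => by ring
  rw [e]
  simp only [o]
  ring

noncomputable def KK (P : ∀ i, Fin (d i) × Fin (d i)) : Matrix (Idx d) (Idx d) ℂ :=
  fun x u => ∏ i, kk (P i) (x i) (u i)

theorem full_eq (Z : Matrix (Idx d) (Idx d) ℂ) :
    full d Z = ((1 / 2 : ℂ) ^ n) •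
      ∑ P : (∀ i, Fin (d i) × Fin (d i)), KK d P * Zᵀ * (KK d P)ᴴ := by
  ext x y
  have hs : ∀ P (x u : Idx d), star (KK d P x u) = KK d P x u := by
    intro P x u
    simp only [KK, star_prod, kk, ind]
    refine Finset.prod_congr rfl fun i _ => ?_
    simp only [star_sub, star_mul', apply_ite star, star_one, star_zero]
  rw [full_apply]
  simp only [Matrix.smul_apply, Matrix.sum_apply, Matrix.mul_apply, Matrix.conjTranspose_apply,
    Matrix.transpose_apply, hs, Finset.sum_mul, smul_eq_mul]
  conv_rhs => rw [Finset.sum_comm, Finset.mul_sum]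
  refine Finset.sum_congr rfl fun v _ => ?_
  conv_rhs => rw [Finset.sum_comm, Finset.mul_sum]
  refine Finset.sum_congr rfl fun u _ => ?_
  have : ∑ P : (∀ i, Fin (d i) × Fin (d i)), KK d P x u * KK d P y v = 2 ^ n *
      ∏ i, (ind (x i) (y i) * ind (u i) (v i) - ind (x i) (v i) * ind (u i) (y i)) := by
    simp only [KK, ← Finset.prod_mul_distrib]
    rw [← Fintype.prod_sum (fun i p => kk p (x i) (u i) * kk p (y i) (v i))]
    simp [site, Finset.prod_mul_distrib]
  have h2 : ∑ P : (∀ i, Fin (d i) × Fin (d i)), KK d P x u * Z v u * KK d P y v =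
    (∑ P : (∀ i, Fin (d i) × Fin (d i)), KK d P x u * KK d P y v) * Z v u := by
    rw [Finset.sum_mul]
    exact Finset.sum_congr rfl fun _ _ => by ring
  rw [h2, this, ← mul_assoc, ← mul_assoc, ← mul_pow]
  norm_num

theorem full_psd {Z : Matrix (Idx d) (Idx d) ℂ} (hZ : Z.PosSemidef) : (full d Z).PosSemidef := by
  rw [full_eq]
  refine Matrix.PosSemidef.smul (Matrix.posSemidef_sum _ fun P _ => ?_) ?_
  · exact hZ.transpose.mul_mul_conjTranspose_same _
  · apply pow_nonneg
    rw [Complex.le_def]; norm_num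

end helpers
end Compat

/-- for odd `n` and any positive semidefinite `Z` on `H`, there is a
compatibility witness `W` with `p(W) = Δ(Z)`. -/
theorem exists_witness_pW_eq_delta {n : ℕ} (d : Fin n → ℕ) (hn : 2 ≤ n) (hd : ∀ i, 1 ≤ d i)
    (hodd : Odd n) (Z : Matrix (Compat.Idx d) (Compat.Idx d) ℂ) (hZ : Z.PosSemidef) :
    ∃ W : Compat.Tuple d, Compat.IsWitness d W ∧ Compat.pW d W = Compat.Δop d Z := by
  have h0 : ∀ A : Finset (Fin n), ∃ i, A ≠ Finset.univ → i ∉ A := by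
    intro A
    by_cases h : A = Finset.univ
    · exact ⟨⟨0, by omega⟩, fun h' => absurd h h'⟩
    · have : ∃ i, i ∉ A := by
        by_contra! hc
        exact h (Finset.eq_univ_iff_forall.mpr hc)
      exact ⟨this.choose, fun _ => this.choose_spec⟩
  choose c hc using h0
  let E : Fin n → Matrix (Compat.Idx d) (Compat.Idx d) ℂ := fun i =>
    ∑ A ∈ (Finset.univ.filter (fun A : Finset (Fin n) => A ≠ Finset.univ)).filter
      (fun A => c A = i), ((-1 : ℂ) ^ A.card) • Compat.embed d A (Compat.reduce d A Z)
  let z0 : ∀ i : Fin n, Compat.SubIdx d ({i}ᶜ)ᶜ := fun i j => ⟨0, hd j.1⟩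
  let W : Compat.Tuple d := fun i x y =>
    E i (Compat.glue d {i}ᶜ x (z0 i)) (Compat.glue d {i}ᶜ y (z0 i))
  have hE : ∀ i, (E i).IsHermitian := by
    intro i
    have : ∀ A : Finset (Fin n), star ((-1 : ℂ) ^ A.card) = (-1 : ℂ) ^ A.card := by
      intro A; simp
    simp only [Matrix.IsHermitian, E, Matrix.conjTranspose_sum, Matrix.conjTranspose_smul, this,
      (Compat.embed_herm d _ (Compat.reduce_herm d _ hZ.1)).eq]
  have hp : Compat.pW d W = Compat.Δop d Z := by
    have h1 : ∀ i, Compat.embed d {i}ᶜ (W i) = E i := by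
      intro i
      ext x y
      have key : ∀ A : Finset (Fin n), i ∉ A → ∀ M,
          Compat.embed d A M x y = if x i = y i then
            Compat.embed d A M (Compat.glue d {i}ᶜ (fun j => x j.1) (z0 i))
              (Compat.glue d {i}ᶜ (fun j => y j.1) (z0 i)) else 0 := by
        intro A hA M
        have g : ∀ (x : Compat.Idx d) j, j ≠ i →
            Compat.glue d {i}ᶜ (fun j => x j.1) (z0 i) j = x j := by
          intro x j hj
          simp [Compat.glue, hj]
        have g' : ∀ (x : Compat.Idx d),
            Compat.glue d {i}ᶜ (fun j => x j.1) (z0 i) i = ⟨0, hd i⟩ := by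
          intro x
          simp [Compat.glue, z0]
        have r : ∀ (x : Compat.Idx d),
            (fun j : A => Compat.glue d {i}ᶜ (fun j => x j.1) (z0 i) j.1) = fun j : A => x j.1 := by
          intro x
          ext1 j
          exact g x _ (fun h => hA (h ▸ j.2))
        have e : (∀ j ∈ Aᶜ, x j = y j) ↔ (x i = y i ∧ ∀ j ∈ Aᶜ,
            Compat.glue d {i}ᶜ (fun j => x j.1) (z0 i) j =
            Compat.glue d {i}ᶜ (fun j => y j.1) (z0 i) j) := by
          constructor
          · intro h
            refine ⟨h i (Finset.mem_compl.mpr hA), fun j hj => ?_⟩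
            by_cases hji : j = i
            · subst hji; rw [g', g']
            · rw [g _ _ hji, g _ _ hji]; exact h j hj
          · rintro ⟨h, h'⟩ j hj
            by_cases hji : j = i
            · subst hji; exact h
            · have := h' j hj
              rwa [g _ _ hji, g _ _ hji] at this
        simp only [Compat.embed, e, r, ite_and]
      have hcond : (∀ j ∈ (({i}ᶜ : Finset (Fin n)))ᶜ, x j = y j) ↔ x i = y i := by simp
      have hL : Compat.embed d {i}ᶜ (W i) x y = if x i = y i then
          W i (fun j => x j.1) (fun j => y j.1) else 0 := by
        simp only [Compat.embed, hcond]
      rw [hL]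
      simp only [W, E, Matrix.sum_apply, Matrix.smul_apply]
      by_cases hxy : x i = y i
      · rw [if_pos hxy]
        refine Finset.sum_congr rfl fun A hA => ?_
        simp only [Finset.mem_filter, Finset.mem_univ, true_and] at hA
        rw [key A (hA.2 ▸ hc A hA.1), if_pos hxy]
      · rw [if_neg hxy]
        symm
        refine Finset.sum_eq_zero fun A hA => ?_
        simp only [Finset.mem_filter, Finset.mem_univ, true_and] at hA
        rw [key A (hA.2 ▸ hc A hA.1), if_neg hxy, smul_zero]
    unfold Compat.pW Compat.Δop
    simp only [h1, E]
    exact Finset.sum_fiberwise _ _ _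
  refine ⟨W, ⟨?_, ?_⟩, hp⟩
  · intro i
    ext x y
    exact (hE i).apply _ _
  · rintro σ ⟨ρ, hρ, hσ⟩
    have : ∑ i, (W i * σ i).trace = (Compat.Δop d Z * ρ).trace := by
      rw [← hp, Compat.pW, Matrix.sum_mul, Matrix.trace_sum]
      exact Finset.sum_congr rfl fun i _ => by rw [hσ i, Compat.trace_embed_mul]
    unfold Compat.cwip
    rw [this, Compat.delta_eq d hodd]
    exact (Complex.le_def.mp (Compat.trace_mul_nonneg ((Compat.full_psd d hZ).add hZ) hρ.1)).1
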